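/- There exist weights α ∈ ℝ^{n-1}_{>0} and input y ∈ ℝⁿ such that the solution path of the weighted 1-D fused lasso has at least n(n−1)/2 distinct linear segments, i.e. Ω(n²) segments. -/

import Mathlib

/-- Objective of the weighted 1-D fused lasso on an input of size `n+1`. -/
noncomputable def fusedObj (n : ℕ) (y : Fin (n + 1) → ℝ) (α : Fin n → ℝ) (γ : ℝ)
    (x : Fin (n + 1) → ℝ) : ℝ :=
  (1 / 2) * ∑ t, (x t - y t) ^ 2 + γ * ∑ t : Fin n, α t * |x t.succ - x t.castSucc|

/-- Summation by parts for a sequence vanishing at both ends. -/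
lemma sum_mul_diff_eq_neg_sum_diff_mul (n : ℕ) (u : ℕ → ℝ) (hu0 : u 0 = 0) (hun : u (n + 1) = 0)
    (v : Fin (n + 1) → ℝ) :
    ∑ t : Fin n, u (t + 1) * (v t.succ - v t.castSucc) =
      -∑ t : Fin (n + 1), (u (t + 1) - u t) * v t := by
  have h1 : ∑ t : Fin (n + 1), u (t + 1) * v t
      = ∑ t : Fin n, u (t + 1) * v t.castSucc := by
    rw [Fin.sum_univ_castSucc]
    simp [hun]
  have h2 : ∑ t : Fin (n + 1), u t * v t = ∑ t : Fin n, u (t + 1) * v t.succ := by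
    rw [Fin.sum_univ_succ]
    simp [hu0]
  simp only [sub_mul, mul_sub, Finset.sum_sub_distrib, h1, h2]
  ring

/-- A point with a dual certificate is the only minimizer of the fused lasso objective. -/
lemma fusedObj_minimizer_eq_of_dual_certificate {n : ℕ} {y : Fin (n + 1) → ℝ} {α : Fin n → ℝ}
    {γ : ℝ} {x z : Fin (n + 1) → ℝ} {u : ℕ → ℝ} (hu0 : u 0 = 0) (hun : u (n + 1) = 0)
    (hx : ∀ t : Fin (n + 1), x t - y t = u (t + 1) - u t)
    (hu : ∀ t : Fin n, |u (t + 1)| ≤ γ * α t)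
    (hc : ∀ t : Fin n, u (t + 1) * (x t.succ - x t.castSucc)
      = γ * α t * |x t.succ - x t.castSucc|)
    (hz : ∀ v, fusedObj n y α γ z ≤ fusedObj n y α γ v) : z = x := by
  have hz' := hz x
  unfold fusedObj at hz'
  have hxs : γ * ∑ t : Fin n, α t * |x t.succ - x t.castSucc|
      = -∑ t : Fin (n + 1), (x t - y t) * x t := by
    simp only [hx]
    rw [← sum_mul_diff_eq_neg_sum_diff_mul n u hu0 hun x, Finset.mul_sum]
    exact Finset.sum_congr rfl fun t _ => by rw [hc t]; ring
  have hzs : -∑ t : Fin (n + 1), (x t - y t) * z t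
      ≤ γ * ∑ t : Fin n, α t * |z t.succ - z t.castSucc| := by
    simp only [hx]
    rw [← sum_mul_diff_eq_neg_sum_diff_mul n u hu0 hun z, Finset.mul_sum]
    refine Finset.sum_le_sum fun t _ => ?_
    calc u (t + 1) * (z t.succ - z t.castSucc)
        ≤ |u (t + 1) * (z t.succ - z t.castSucc)| := le_abs_self _
      _ = |u (t + 1)| * |z t.succ - z t.castSucc| := abs_mul _ _
      _ ≤ γ * α t * |z t.succ - z t.castSucc| :=
        mul_le_mul_of_nonneg_right (hu t) (abs_nonneg _)
      _ = _ := by ring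
  have hsum : ∑ t, (z t - x t) ^ 2 = ∑ t, (z t - y t) ^ 2 - ∑ t, (x t - y t) ^ 2
      - 2 * ∑ t, (x t - y t) * z t + 2 * ∑ t, (x t - y t) * x t := by
    simp only [Finset.mul_sum, ← Finset.sum_sub_distrib, ← Finset.sum_add_distrib]
    exact Finset.sum_congr rfl fun t _ => by ring
  have h0 : ∑ t, (z t - x t) ^ 2 ≤ 0 := by linarith
  have h1 := (Finset.sum_eq_zero_iff_of_nonneg (fun t _ => sq_nonneg (z t - x t))).1
    (le_antisymm h0 (Finset.sum_nonneg fun t _ => sq_nonneg _))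
  funext t
  have := pow_eq_zero_iff (two_ne_zero) |>.1 (h1 t (Finset.mem_univ t))
  linarith

/-- Half-width of the tube at position `t`: quadratic inside, pinned at the right end. -/
noncomputable def tubeRadius (n t : ℕ) : ℝ := if t ≤ n then (t : ℝ) ^ 2 else 0

lemma tubeRadius_nonneg (n t : ℕ) : 0 ≤ tubeRadius n t := by
  unfold tubeRadius; split_ifs <;> positivity

lemma tubeRadius_le (n t : ℕ) : tubeRadius n t ≤ (n + 1 : ℝ) ^ 2 := by
  unfold tubeRadius
  split_ifs with h
  · have : (t : ℝ) ≤ n := by exact_mod_cast h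
    gcongr
    linarith
  · positivity

/-- Vertical displacement of node `j + 1` at which the taut string follows the tube up to node `i`
and leaves it with slope `s`. -/
noncomputable def liftHeight (n j i : ℕ) (s : ℝ) : ℝ :=
  tubeRadius n (j + 1) + (i : ℝ) ^ 2 + s * (j + 1 - i)

lemma quarter_le_liftHeight {n j i : ℕ} (hij : i < j) {s : ℝ} (hs : 2 * (i : ℝ) + 1 / 4 ≤ s) :
    1 / 4 ≤ liftHeight n j i s := by
  have h : (i : ℝ) + 1 ≤ j := by exact_mod_cast hij
  have h0 : (0 : ℝ) ≤ i := by positivity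
  have := tubeRadius_nonneg n (j + 1)
  unfold liftHeight
  nlinarith [sq_nonneg (i : ℝ)]

lemma liftHeight_le {n j i : ℕ} (hij : i < j) (hj : j ≤ n) {s : ℝ}
    (hs : s ≤ 2 * (i : ℝ) + 1 / 2) : liftHeight n j i s ≤ 4 * (n + 1 : ℝ) ^ 2 := by
  have h : (i : ℝ) + 1 ≤ j := by exact_mod_cast hij
  have hj' : (j : ℝ) ≤ n := by exact_mod_cast hj
  have h0 : (0 : ℝ) ≤ i := by positivity
  have := tubeRadius_le n (j + 1)
  unfold liftHeight
  have h1 : s * (j + 1 - i) ≤ (2 * i + 1 / 2) * (j + 1 - i) :=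
    mul_le_mul_of_nonneg_right hs (by linarith)
  have h2 : (2 * (i : ℝ) + 1 / 2) * (j + 1 - i) ≤ (2 * n + 1 / 2) * (n + 1) := by
    apply mul_le_mul <;> linarith
  have h3 : (i : ℝ) ^ 2 ≤ (n : ℝ) ^ 2 := by gcongr; linarith
  nlinarith

/-- The taut string that follows the tube on nodes `0, …, i`, is straight between `i` and `j + 1`,
and zigzags from `j + 1` on. -/
lemma exists_tautString {n j i : ℕ} (hij : i < j) (hj : j ≤ n) {K l s : ℝ}
    (hK : 100 * (n + 1 : ℝ) ^ 2 ≤ K) (hs1 : 2 * (i : ℝ) + 1 / 4 ≤ s)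
    (hs2 : s ≤ 2 * (i : ℝ) + 1 / 2) (hl : l * K ^ (j + 1) = liftHeight n j i s)
    {w : ℕ → ℝ} (hw : ∀ t, w t = (-1) ^ (t + j + 1) * (l * K ^ t)) :
    ∃ h : ℕ → ℝ, h 0 = w 0 ∧ h (n + 1) = w (n + 1) ∧
      (∀ t, 1 ≤ t → t ≤ n → |h t - w t| ≤ (t : ℝ) ^ 2 ∧
        (h t - w t) * (h (t + 1) - 2 * h t + h (t - 1))
          = (t : ℝ) ^ 2 * |h (t + 1) - 2 * h t + h (t - 1)|) ∧
      h (i + 2) - 2 * h (i + 1) + h i = 0 ∧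
      (1 ≤ i → h (i + 1) - 2 * h i + h (i - 1) ≠ 0) ∧
      (j < n → h (j + 2) - 2 * h (j + 1) + h j ≠ 0) := by
  have hn1 : (1 : ℝ) ≤ (n + 1 : ℝ) ^ 2 := by
    have : (0 : ℝ) ≤ n := by positivity
    nlinarith
  have hK1 : 1 ≤ K := by linarith
  have hK0 : 0 < K := by linarith
  have hij' : (i : ℝ) + 1 ≤ j := by exact_mod_cast hij
  have hj' : (j : ℝ) ≤ n := by exact_mod_cast hj
  have hi0 : (0 : ℝ) ≤ i := by positivity
  have hC1 := quarter_le_liftHeight (n := n) hij hs1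
  have hC2 := liftHeight_le hij hj hs2
  have hl0 : 0 < l := by
    have h1 : 0 < l * K ^ (j + 1) := by rw [hl]; linarith
    exact (pos_iff_pos_of_mul_pos h1).2 (by positivity)
  have hwb : ∀ t ≤ j, |w t| ≤ 1 / 10 := by
    intro t ht
    rw [hw, abs_mul, abs_pow, abs_neg, abs_one, one_pow, one_mul, abs_of_nonneg (by positivity)]
    have h1 : l * K ^ t ≤ l * K ^ j :=
      mul_le_mul_of_nonneg_left (pow_le_pow_right₀ hK1 ht) hl0.le
    have h2 : l * K ^ j * K ≤ 1 / 10 * K := by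
      have : l * K ^ j * K = liftHeight n j i s := by rw [← hl]; ring
      linarith
    exact h1.trans (le_of_mul_le_mul_right h2 hK0)
  have hbig : ∀ t, j + 2 ≤ t → 25 * (n + 1 : ℝ) ^ 2 ≤ l * K ^ t := by
    intro t ht
    have h1 : l * K ^ (j + 2) ≤ l * K ^ t :=
      mul_le_mul_of_nonneg_left (pow_le_pow_right₀ hK1 ht) hl0.le
    have h2 : l * K ^ (j + 2) = liftHeight n j i s * K := by rw [← hl]; ring
    nlinarith
  obtain ⟨r, hr⟩ : ∃ r : ℕ → ℝ, ∀ t, r t = l * K ^ t - tubeRadius n t := ⟨_, fun _ => rfl⟩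
  have hr1 : r (j + 1) = (i : ℝ) ^ 2 + s * (j + 1 - i) := by
    rw [hr, hl, liftHeight]; ring
  have hr1pos : 0 < r (j + 1) := by rw [hr1]; nlinarith [sq_nonneg (i : ℝ)]
  have hr2 : ∀ t, j + 2 ≤ t → 24 * (n + 1 : ℝ) ^ 2 ≤ r t := by
    intro t ht
    have := hbig t ht
    have := tubeRadius_le n t
    rw [hr]; linarith
  have hrpos : ∀ t, j + 1 ≤ t → 0 < r t := by
    intro t ht
    rcases ht.eq_or_lt with rfl | ht
    · exact hr1pos
    · have := hr2 t ht
      linarith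
  have hm : (0 : ℝ) < j + 1 - i := by linarith
  obtain ⟨σ, hσ⟩ : ∃ σ : ℝ, σ = s - w i / (j + 1 - i) := ⟨_, rfl⟩
  have hσm : σ * (j + 1 - i) = s * (j + 1 - i) - w i := by
    rw [hσ, sub_mul, div_mul_cancel₀ _ hm.ne']
  have hwi := abs_le.1 (hwb i hij.le)
  have hσ1 : s - 1 / 10 ≤ σ := by nlinarith
  have hσ2 : σ ≤ s + 1 / 10 := by nlinarith
  obtain ⟨h, hh⟩ : ∃ h : ℕ → ℝ, ∀ t, h t = if t ≤ i then (t : ℝ) ^ 2 + w t else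
      if t ≤ j then (i : ℝ) ^ 2 + w i + σ * (t - i) else (-1) ^ (t + j + 1) * r t :=
    ⟨_, fun _ => rfl⟩
  have hA : ∀ t ≤ i, h t = (t : ℝ) ^ 2 + w t := fun t ht => by rw [hh, if_pos ht]
  have hC : ∀ t, j + 1 ≤ t → h t = (-1) ^ (t + j + 1) * r t := fun t ht => by
    rw [hh, if_neg (by omega), if_neg (by omega)]
  have hB : ∀ t, i ≤ t → t ≤ j + 1 → h t = (i : ℝ) ^ 2 + w i + σ * (t - i) := by
    intro t h1 h2
    rcases h1.eq_or_lt with rfl | h1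
    · rw [hA i le_rfl]; ring
    rcases h2.eq_or_lt with rfl | h2
    · rw [hC _ le_rfl, hr1, Even.neg_one_pow ⟨j + 1, by ring⟩]
      push_cast
      linarith
    · rw [hh, if_neg (by omega), if_pos (by omega)]
  have hfollow : ∀ t, 1 ≤ t → t ≤ i → 0 < h (t + 1) - 2 * h t + h (t - 1) := by
    intro t h1 h2
    obtain ⟨m, rfl⟩ : ∃ m, t = m + 1 := ⟨t - 1, by omega⟩
    rw [Nat.add_sub_cancel]
    have w0 := abs_le.1 (hwb m (by omega))
    have w1 := abs_le.1 (hwb (m + 1) (by omega))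
    rcases h2.eq_or_lt with rfl | h2
    · rw [hB (m + 1 + 1) (by omega) (by omega), hA (m + 1) le_rfl, hA m (by omega)]
      push_cast at *
      linarith
    · have w2 := abs_le.1 (hwb (m + 1 + 1) (by omega))
      rw [hA (m + 1 + 1) (by omega), hA (m + 1) (by omega), hA m (by omega)]
      push_cast
      linarith
  have hstraight : ∀ t, i + 1 ≤ t → t ≤ j → h (t + 1) - 2 * h t + h (t - 1) = 0 := by
    intro t h1 h2
    obtain ⟨m, rfl⟩ : ∃ m, t = m + 1 := ⟨t - 1, by omega⟩
    rw [Nat.add_sub_cancel, hB (m + 1 + 1) (by omega) (by omega), hB (m + 1) (by omega) (by omega),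
      hB m (by omega) (by omega)]
    push_cast
    ring
  have hinside : ∀ t, i + 1 ≤ t → t ≤ j → |h t - w t| ≤ (t : ℝ) ^ 2 := by
    intro t h1 h2
    rw [hB t (by omega) (by omega)]
    have wt := abs_le.1 (hwb t h2)
    have hti : (i : ℝ) + 1 ≤ t := by exact_mod_cast h1
    have hlow : 0 ≤ σ * (t - i) := mul_nonneg (by linarith) (by linarith)
    have hup : σ * (t - i) ≤ (2 * i + 3 / 5) * (t - i) :=
      mul_le_mul_of_nonneg_right (by linarith) (by linarith)
    have hsq : ((t : ℝ) - i) * 1 ≤ (t - i) * (t - i) :=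
      mul_le_mul_of_nonneg_left (by linarith) (by linarith)
    have hexp : (t : ℝ) ^ 2 = i ^ 2 + 2 * i * (t - i) + (t - i) * (t - i) := by ring
    have hcross : 0 ≤ 2 * (i : ℝ) * (t - i) := mul_nonneg (by linarith) (by linarith)
    have hisq : 0 ≤ (i : ℝ) ^ 2 := sq_nonneg _
    rw [abs_le, hexp]
    constructor <;> linarith
  have hkink : h (j + 1 + 1) - 2 * h (j + 1) + h j < 0 := by
    have h1 : h (j + 1) = r (j + 1) := by
      rw [hC _ le_rfl, Even.neg_one_pow ⟨j + 1, by ring⟩, one_mul]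
    have h2 : h (j + 1 + 1) = - r (j + 2) := by
      rw [hC _ (by omega), Odd.neg_one_pow ⟨j + 1, by ring⟩]
      ring_nf
    have h3 := abs_le.1 (hinside j hij le_rfl)
    have h4 := abs_le.1 (hwb j le_rfl)
    have h5 := hr2 (j + 2) le_rfl
    have h6 : (j : ℝ) ^ 2 ≤ (n + 1 : ℝ) ^ 2 := by gcongr; linarith
    rw [h1, h2]
    linarith
  refine ⟨h, ?_, ?_, ?_, ?_, ?_, ?_⟩
  · rw [hA 0 (by omega)]; simp
  · rw [hC _ (by omega), hw, hr, tubeRadius, if_neg (by omega), sub_zero]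
  · intro t h1 h2
    have hrad : tubeRadius n t = (t : ℝ) ^ 2 := if_pos h2
    have hoff : j + 1 ≤ t → h t - w t = -((-1) ^ (t + j + 1) * (t : ℝ) ^ 2) := fun ht => by
      rw [hC t ht, hw, hr, hrad]; ring
    rcases le_or_gt t i with hti | hti
    · have hoff' : h t - w t = (t : ℝ) ^ 2 := by rw [hA t hti]; ring
      rw [hoff', abs_of_pos (hfollow t h1 hti), abs_of_nonneg (by positivity)]
      exact ⟨le_rfl, rfl⟩
    rcases le_or_gt t j with htj | htj
    · refine ⟨hinside t hti htj, ?_⟩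
      rw [hstraight t hti htj]; simp
    refine ⟨?_, ?_⟩
    · rw [hoff htj, abs_neg, abs_mul, abs_pow, abs_neg, abs_one, one_pow, one_mul,
        abs_of_nonneg (by positivity)]
    rw [hoff htj]
    rcases (show j + 1 ≤ t from htj).eq_or_lt with rfl | htj2
    · rw [Nat.add_sub_cancel, abs_of_neg hkink, Even.neg_one_pow ⟨j + 1, by ring⟩]
      ring
    · obtain ⟨m, rfl⟩ : ∃ m, t = m + 1 := ⟨t - 1, by omega⟩
      have e1 : h (m + 1 + 1) - 2 * h (m + 1) + h (m + 1 - 1)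
          = -((-1) ^ (m + 1 + j + 1) * (r (m + 1 + 1) + 2 * r (m + 1) + r m)) := by
        rw [Nat.add_sub_cancel, hC (m + 1 + 1) (by omega), hC (m + 1) (by omega), hC m (by omega)]
        ring
      have hR : 0 < r (m + 1 + 1) + 2 * r (m + 1) + r m := by
        have := hrpos (m + 1 + 1) (by omega)
        have := hrpos (m + 1) (by omega)
        have := hrpos m (by omega)
        linarith
      rw [e1, abs_neg, abs_mul, abs_pow, abs_neg, abs_one, one_pow, one_mul, abs_of_pos hR]
      rcases neg_one_pow_eq_or ℝ (m + 1 + j + 1) with h | h <;> rw [h] <;> ring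
  · exact hstraight (i + 1) le_rfl hij
  · exact fun hi => (hfollow i hi le_rfl).ne'
  · exact fun _ => hkink.ne

/-- Regularization parameter at which the string leaves node `i` with slope `s` and returns to the
tube at node `j + 1`. -/
noncomputable def stateParam (n : ℕ) (K : ℝ) (j i : ℕ) (s : ℝ) : ℝ :=
  K ^ (j + 1) / liftHeight n j i s

/-- Which consecutive coordinates of the minimizer agree at `stateParam`. -/
lemma minimizer_at_stateParam {n j i : ℕ} (hij : i < j) (hj : j ≤ n) {K s : ℝ}
    (hK : 100 * (n + 1 : ℝ) ^ 2 ≤ K) (hs1 : 2 * (i : ℝ) + 1 / 4 ≤ s)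
    (hs2 : s ≤ 2 * (i : ℝ) + 1 / 2) {z : Fin (n + 1) → ℝ}
    (hz : ∀ v, fusedObj n (fun t => (-K) ^ (t.val + 1) - (-K) ^ t.val)
      (fun t => ((t : ℝ) + 1) ^ 2) (stateParam n K j i s) z
      ≤ fusedObj n (fun t => (-K) ^ (t.val + 1) - (-K) ^ t.val)
      (fun t => ((t : ℝ) + 1) ^ 2) (stateParam n K j i s) v) :
    (∀ t : Fin n, t.val = i → z t.succ - z t.castSucc = 0) ∧
    (∀ t : Fin n, t.val + 1 = i → z t.succ - z t.castSucc ≠ 0) ∧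
    (∀ t : Fin n, t.val = j → z t.succ - z t.castSucc ≠ 0) := by
  have hn1 : (0 : ℝ) < (n + 1 : ℝ) ^ 2 := by positivity
  have hK0 : 0 < K := by linarith
  have hC1 := quarter_le_liftHeight (n := n) hij hs1
  have hC0 : 0 < liftHeight n j i s := by linarith
  obtain ⟨γ, hγ⟩ : ∃ γ, γ = stateParam n K j i s := ⟨_, rfl⟩
  rw [← hγ] at hz
  have hγ0 : 0 < γ := by rw [hγ, stateParam]; positivity
  have hl : γ⁻¹ * K ^ (j + 1) = liftHeight n j i s := by
    rw [hγ, stateParam]; field_simp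
  obtain ⟨w, hw⟩ : ∃ w : ℕ → ℝ, ∀ t, w t = (-1) ^ (t + j + 1) * (γ⁻¹ * K ^ t) :=
    ⟨_, fun _ => rfl⟩
  obtain ⟨h, h0, hend, hmid, hfree, hi, hjn⟩ := exists_tautString hij hj hK hs1 hs2 hl hw
  obtain ⟨ε, hε⟩ : ∃ ε : ℝ, ε = (-1) ^ (j + 1) := ⟨_, rfl⟩
  have hε2 : ε = 1 ∨ ε = -1 := hε ▸ neg_one_pow_eq_or ℝ (j + 1)
  have hεε : ε * ε = 1 := by rcases hε2 with h | h <;> rw [h] <;> norm_num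
  have hwY : ∀ t, γ * ε * w t = (-K) ^ t := by
    intro t
    have : w t = (-1) ^ t * ε * (γ⁻¹ * K ^ t) := by rw [hw, hε]; ring
    rw [this, neg_pow K]
    calc γ * ε * ((-1) ^ t * ε * (γ⁻¹ * K ^ t)) = (γ * γ⁻¹) * (ε * ε) * ((-1) ^ t * K ^ t) := by ring
      _ = _ := by rw [hεε, mul_inv_cancel₀ hγ0.ne']; ring
  have hzx : z = fun t : Fin (n + 1) => γ * ε * (h (t.val + 1) - h t.val) := by
    refine fusedObj_minimizer_eq_of_dual_certificate
      (u := fun t => γ * ε * (h t - w t)) ?_ ?_ ?_ ?_ ?_ hz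
    · simp [h0]
    · simp [hend]
    · intro t
      simp only [← hwY]
      ring
    · intro t
      have := (hmid (t + 1) (by omega) (by omega)).1
      have hε1 : |ε| = 1 := by rcases hε2 with h | h <;> rw [h] <;> norm_num
      simp only [abs_mul, hε1, abs_of_pos hγ0, mul_one]
      push_cast at this
      exact mul_le_mul_of_nonneg_left this hγ0.le
    · intro t
      have := (hmid (t + 1) (by omega) (by omega)).2
      push_cast at this
      have hd : γ * ε * (h (t.val + 1 + 1) - h (t.val + 1)) - γ * ε * (h (t.val + 1) - h t.val)
          = γ * ε * (h (t.val + 1 + 1) - 2 * h (t.val + 1) + h t.val) := by ring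
      have hε1 : |ε| = 1 := by rcases hε2 with h | h <;> rw [h] <;> norm_num
      simp only [Fin.val_succ, Fin.val_castSucc, hd, abs_mul, hε1, abs_of_pos hγ0, mul_one]
      linear_combination γ * γ * this
        + γ * γ * (h (t + 1) - w (t + 1)) * (h (t + 1 + 1) - 2 * h (t + 1) + h t) * hεε
  have hdiff : ∀ t : Fin n, z t.succ - z t.castSucc
      = γ * ε * (h (t.val + 1 + 1) - 2 * h (t.val + 1) + h t.val) := by
    intro t
    rw [hzx]
    simp only [Fin.val_succ, Fin.val_castSucc]
    ring
  have hγε : γ * ε ≠ 0 := mul_ne_zero hγ0.ne' (by rcases hε2 with h | h <;> rw [h] <;> norm_num)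
  refine ⟨?_, ?_, ?_⟩
  · intro t ht
    rw [hdiff, ht, hfree, mul_zero]
  · intro t ht
    have := hi (by omega)
    rw [hdiff]
    subst ht
    exact mul_ne_zero hγε this
  · intro t ht
    have := hjn (by omega)
    rw [hdiff, ht]
    exact mul_ne_zero hγε this

lemma stateParam_lt_of_slope {n j i : ℕ} (hij : i < j) {K : ℝ} (hK : 0 < K) {s s' : ℝ}
    (hs : 2 * (i : ℝ) + 1 / 4 ≤ s) (hss : s < s') :
    stateParam n K j i s' < stateParam n K j i s := by
  have h1 := quarter_le_liftHeight (n := n) hij hs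
  have h : (i : ℝ) + 1 ≤ j := by exact_mod_cast hij
  refine div_lt_div_of_pos_left (by positivity) (by linarith) ?_
  unfold liftHeight
  nlinarith

lemma stateParam_lt_of_node {n j i : ℕ} (hij : i + 1 < j) {K : ℝ} (hK : 0 < K) :
    stateParam n K j (i + 1) (2 * (i + 1 : ℕ) + 1 / 4) < stateParam n K j i (2 * i + 1 / 2) := by
  have h1 := quarter_le_liftHeight (n := n) (i := i) (j := j) (by omega)
    (s := 2 * i + 1 / 2) (by linarith)
  have h : (i : ℝ) + 1 + 1 ≤ j := by exact_mod_cast hij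
  refine div_lt_div_of_pos_left (by positivity) (by linarith) ?_
  unfold liftHeight
  push_cast
  nlinarith

lemma stateParam_lt_of_stage {n j i : ℕ} (hij : i < j) (hj : j + 1 ≤ n) {K : ℝ}
    (hK : 100 * (n + 1 : ℝ) ^ 2 ≤ K) {s s' : ℝ} (hs : 2 * (i : ℝ) + 1 / 4 ≤ s)
    {i' : ℕ} (hi' : i' < j + 1) (hs1' : 2 * (i' : ℝ) + 1 / 4 ≤ s')
    (hs2' : s' ≤ 2 * (i' : ℝ) + 1 / 2) :
    stateParam n K j i s < stateParam n K (j + 1) i' s' := by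
  have hn1 : (0 : ℝ) < (n + 1 : ℝ) ^ 2 := by positivity
  have hK0 : 0 < K := by linarith
  have h1 := quarter_le_liftHeight (n := n) hij hs
  have h2 := quarter_le_liftHeight (n := n) hi' hs1'
  have h3 := liftHeight_le hi' hj hs2'
  unfold stateParam
  rw [div_lt_div_iff₀ (by linarith) (by linarith), pow_succ K (j + 1), mul_assoc]
  refine mul_lt_mul_of_pos_left ?_ (by positivity)
  nlinarith

/-- Every point right of `c 0` lies in a last piece starting before it. -/
lemma exists_last_breakpoint_le {k : ℕ} (c : Fin (k + 1) → ℝ) {γ : ℝ} (hγ : c 0 ≤ γ) :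
    ∃ m, c m ≤ γ ∧ ∀ m', m < m' → γ < c m' := by
  obtain ⟨m, hm, hmax⟩ := Finset.exists_max_image (Finset.univ.filter fun m => c m ≤ γ) id
    ⟨0, by simpa using hγ⟩
  refine ⟨m, by simpa using hm, fun m' h => ?_⟩
  by_contra hc
  exact absurd (hmax m' (by simpa using hc)) (not_le.2 h)

/-- If `z` is piecewise affine with breakpoints `c`, and a difference of two coordinates is nonzero
at `γ₁` but vanishes at `γ₂ < γ₃` right of it, then `γ₁` and `γ₃` lie in different pieces. -/
lemma piece_lt_of_fusion {ι : Type*} {k : ℕ} {z : ℝ → ι → ℝ} {c : Fin (k + 1) → ℝ}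
    (hpiece : ∀ i : Fin k, ∃ a b : ι → ℝ,
      ∀ γ ∈ Set.Icc (c i.castSucc) (c i.succ), ∀ t, z γ t = a t + γ * b t)
    (hlast : ∃ a b : ι → ℝ, ∀ γ ∈ Set.Ici (c (Fin.last k)), ∀ t, z γ t = a t + γ * b t)
    {γ₁ γ₂ γ₃ : ℝ} (h12 : γ₁ < γ₂) (h23 : γ₂ < γ₃) {p q : ι} (h1 : z γ₁ p - z γ₁ q ≠ 0)
    (h2 : z γ₂ p - z γ₂ q = 0) (h3 : z γ₃ p - z γ₃ q = 0) {m₁ m₃ : Fin (k + 1)}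
    (hm₁ : c m₁ ≤ γ₁) (hm₃ : c m₃ ≤ γ₃ ∧ ∀ m', m₃ < m' → γ₃ < c m') : m₁ < m₃ := by
  by_contra hlt
  rcases (not_lt.1 hlt).eq_or_lt with rfl | hgt
  · obtain ⟨a, b, hab⟩ : ∃ a b : ι → ℝ, ∀ γ, γ₁ ≤ γ → γ ≤ γ₃ → ∀ t, z γ t = a t + γ * b t := by
      induction m₃ using Fin.lastCases with
      | last =>
        obtain ⟨a, b, hab⟩ := hlast
        exact ⟨a, b, fun γ h _ => hab γ (hm₁.trans h)⟩
      | cast m =>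
        obtain ⟨a, b, hab⟩ := hpiece m
        exact ⟨a, b, fun γ h h' => hab γ
          ⟨hm₁.trans h, h'.trans (hm₃.2 m.succ (Fin.castSucc_lt_succ)).le⟩⟩
    rw [hab γ₁ le_rfl (h12.trans h23).le, hab γ₁ le_rfl (h12.trans h23).le] at h1
    rw [hab γ₂ h12.le h23.le, hab γ₂ h12.le h23.le] at h2
    rw [hab γ₃ (h12.trans h23).le le_rfl, hab γ₃ (h12.trans h23).le le_rfl] at h3
    have hb : b p - b q = 0 := by
      have : (γ₃ - γ₂) * (b p - b q) = 0 := by linear_combination h3 - h2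
      exact (mul_eq_zero.1 this).resolve_left (by linarith)
    exact h1 (by linear_combination h2 + (γ₁ - γ₂) * hb)
  · linarith [hm₃.2 m₁ hgt]

/-- There exist strictly positive weights `α` and an input `y` of size `n+1` such that
the solution path of the weighted 1-D fused lasso has at least `(n+1)·n/2 = Ω(n²)`
distinct linear segments: every decomposition of `[0,∞)` into consecutive intervals on
which `γ ↦ x*(γ)` is affine uses at least `(n+1)·n/2` pieces. -/
theorem weighted_fused_lasso_quadratic_lower_bound (n : ℕ) :
    ∃ (α : Fin n → ℝ) (y : Fin (n + 1) → ℝ), (∀ t, 0 < α t) ∧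
      ∀ (x : ℝ → Fin (n + 1) → ℝ),
        (∀ γ, 0 ≤ γ → ∀ v, fusedObj n y α γ (x γ) ≤ fusedObj n y α γ v) →
        ∀ (k : ℕ) (c : Fin (k + 1) → ℝ), c 0 = 0 → StrictMono c →
          (∀ i : Fin k, ∃ a b : Fin (n + 1) → ℝ,
            ∀ γ ∈ Set.Icc (c i.castSucc) (c i.succ), ∀ t, x γ t = a t + γ * b t) →
          (∃ a b : Fin (n + 1) → ℝ,
            ∀ γ ∈ Set.Ici (c (Fin.last k)), ∀ t, x γ t = a t + γ * b t) →
          (n + 1) * n / 2 ≤ k + 1 := by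
  obtain ⟨K, hK⟩ : ∃ K : ℝ, 100 * (n + 1 : ℝ) ^ 2 ≤ K := ⟨_, le_rfl⟩
  refine ⟨fun t => ((t : ℝ) + 1) ^ 2, fun t => (-K) ^ (t.val + 1) - (-K) ^ t.val,
    fun t => by positivity, ?_⟩
  intro x hx k c hc0 _ hpiece hlast
  have hn1 : (0 : ℝ) < (n + 1 : ℝ) ^ 2 := by positivity
  have hK0 : 0 < K := by linarith
  have hpos : ∀ {j i : ℕ}, i < j → ∀ {s : ℝ}, 2 * (i : ℝ) + 1 / 4 ≤ s →
      0 ≤ stateParam n K j i s := fun hij _ hs =>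
    div_nonneg (by positivity) (by linarith [quarter_le_liftHeight (n := n) hij hs])
  have hlastpiece : ∀ γ, 0 ≤ γ → ∃ m, c m ≤ γ ∧ ∀ m', m < m' → γ < c m' := fun γ hγ =>
    exists_last_breakpoint_le c (hc0.trans_le hγ)
  choose! G hG using hlastpiece
  have hstate : ∀ {j i : ℕ} (hij : i < j) (hj : j ≤ n) {s : ℝ}
      (hs1 : 2 * (i : ℝ) + 1 / 4 ≤ s) (hs2 : s ≤ 2 * (i : ℝ) + 1 / 2), _ :=
    fun hij hj _ hs1 hs2 => minimizer_at_stateParam hij hj hK hs1 hs2 (hx _ (hpos hij hs1))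
  have hstep : ∀ {j i : ℕ} (hij : i < j) (hj : j ≤ n) {γ : ℝ}, 0 ≤ γ →
      γ < stateParam n K j i (2 * i + 1 / 2) →
      x γ (Fin.succ ⟨i, hij.trans_le hj⟩) - x γ (Fin.castSucc ⟨i, hij.trans_le hj⟩) ≠ 0 →
      (G γ).val < (G (stateParam n K j i (2 * i + 1 / 4))).val := by
    intro j i hij hj γ hγ hlt hne
    exact piece_lt_of_fusion hpiece hlast hlt
      (stateParam_lt_of_slope hij hK0 le_rfl (by linarith)) hne
      ((hstate hij hj (by linarith) le_rfl).1 _ rfl)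
      ((hstate hij hj le_rfl (by linarith)).1 _ rfl)
      (hG γ hγ).1 (hG _ (hpos hij le_rfl))
  have hcount : ∀ J, J + 1 ≤ n → ∀ m i, m + i = J →
      J * (J + 1) + 2 * m ≤ 2 * (G (stateParam n K (J + 1) i (2 * i + 1 / 4))).val := by
    intro J
    induction J with
    | zero =>
      intro _ m i hmi
      obtain rfl : m = 0 := by omega
      simp
    | succ J ihJ =>
      intro hJ m
      induction m with
      | zero =>
        intro i hi
        obtain rfl : i = J + 1 := by omega
        have h1 := ihJ (by omega) J 0 (by omega)
        have h2 := hstep (j := J + 1 + 1) (i := J + 1) (by omega) hJ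
          (hpos (j := J + 1) (i := 0) (by omega) le_rfl)
          (stateParam_lt_of_stage (by omega) hJ hK le_rfl (by omega) (by linarith) le_rfl)
          ((hstate (j := J + 1) (i := 0) (by omega) (by omega) le_rfl (by linarith)).2.2 _ rfl)
        nlinarith
      | succ m ihm =>
        intro i hi
        have h1 := ihm (i + 1) (by omega)
        have h2 := hstep (j := J + 1 + 1) (i := i) (by omega) hJ
          (hpos (j := J + 1 + 1) (i := i + 1) (by omega) le_rfl)
          (stateParam_lt_of_node (by omega) hK0)
          ((hstate (j := J + 1 + 1) (i := i + 1) (by omega) hJ le_rfl (by linarith)).2.1 _ rfl)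
        omega
  rcases n with _ | n
  · simp
  · have h1 := hcount n le_rfl n 0 (by omega)
    have h2 := (G (stateParam (n + 1) K (n + 1) 0 (2 * (0 : ℕ) + 1 / 4))).isLt
    apply Nat.div_le_of_le_mul
    nlinarith
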